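/- Let n ≥ 1, s ∈ (1/2,1), C_s > 0, ε, τ > 0 with τ ≤ s ε^{2s}/C_s. Let u₀: ℝⁿ → ℝ be bounded and uniformly continuous and let (U^j) be the solution of the semi-discrete scheme with initial datum u₀. Then for every j, k ∈ ℕ, sup_{x∈ℝⁿ} |U^{j+k}(x) − U^j(x)| ≤ k τ · sup_{x∈ℝⁿ} |L_ε[u₀](x)| (equicontinuity in time with Lipschitz constant given by the truncated operator applied to the initial datum). -/

import Mathlib

open MeasureTheory Metric Set

noncomputable section

abbrev E (n : ℕ) : Type := EuclideanSpace ℝ (Fin n)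

/-- The truncated infinity fractional Laplacian
`L_ε[φ](x) = C_s ⋅ sup_{|y|=1} inf_{|ŷ|=1} ∫_ε^∞ (φ(x+ηy)+φ(x−ηŷ)−2φ(x)) η^{−1−2s} dη`. -/
def iflTrunc (n : ℕ) (s Cs ε : ℝ) (φ : E n → ℝ) (x : E n) : ℝ :=
  Cs * ⨆ y : {y : E n // ‖y‖ = 1}, ⨅ yt : {y : E n // ‖y‖ = 1},
    ∫ η in Ioi ε,
      (φ (x + η • (y : E n)) + φ (x - η • (yt : E n)) - 2 * φ x) / η ^ (1 + 2*s)

/-- The kernel mass `∫_ε^∞ η^{-1-2s} dη`. -/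
lemma integral_Ioi_kernel {s ε : ℝ} (hs : 0 < s) (hε : 0 < ε) :
    ∫ η in Ioi ε, η ^ (-(1 + 2 * s)) = ε ^ (-(2 * s)) / (2 * s) := by
  rw [integral_Ioi_rpow_of_lt (by linarith) hε]
  have h : -(1 + 2 * s) + 1 = -(2 * s) := by ring
  rw [h, neg_div_neg_eq]

lemma integrableOn_secondDifference {n : ℕ} {s ε M : ℝ} (hs : 0 < s) (hε : 0 < ε)
    {φ : E n → ℝ} (hc : Continuous φ) (hM : ∀ z, |φ z| ≤ M) (x y w : E n) :
    IntegrableOn (fun η : ℝ => (φ (x + η • y) + φ (x - η • w) - 2 * φ x) / η ^ (1 + 2 * s))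
      (Ioi ε) := by
  have hk : IntegrableOn (fun η : ℝ => η ^ (-(1 + 2 * s))) (Ioi ε) :=
    integrableOn_Ioi_rpow_of_lt (by linarith) hε
  have h := Integrable.bdd_mul (c := 4 * M)
    (f := fun η : ℝ => φ (x + η • y) + φ (x - η • w) - 2 * φ x) hk
    (by fun_prop : Continuous _).aestronglyMeasurable
    (Filter.Eventually.of_forall fun η => by
      have h1 := abs_le.1 (hM (x + η • y))
      have h2 := abs_le.1 (hM (x - η • w))
      have h3 := abs_le.1 (hM x)
      rw [Real.norm_eq_abs, abs_le]
      constructor <;> linarith)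
  refine IntegrableOn.congr_fun h (fun η hη => ?_) measurableSet_Ioi
  have hη : 0 < η := hε.trans hη
  simp only [Real.rpow_neg hη.le, div_eq_mul_inv]

lemma integral_secondDifference_le {n : ℕ} {s ε M N D : ℝ} (hs : 0 < s) (hε : 0 < ε)
    {φ ψ : E n → ℝ} (hφ : Continuous φ) (hφM : ∀ z, |φ z| ≤ M)
    (hψ : Continuous ψ) (hψN : ∀ z, |ψ z| ≤ N) (hD : ∀ z, φ z - ψ z ≤ D) (x y w : E n) :
    ∫ η in Ioi ε, (φ (x + η • y) + φ (x - η • w) - 2 * φ x) / η ^ (1 + 2 * s) ≤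
      (∫ η in Ioi ε, (ψ (x + η • y) + ψ (x - η • w) - 2 * ψ x) / η ^ (1 + 2 * s)) +
        2 * (D - (φ x - ψ x)) * (ε ^ (-(2 * s)) / (2 * s)) := by
  have hk : IntegrableOn (fun η : ℝ => η ^ (-(1 + 2 * s))) (Ioi ε) :=
    integrableOn_Ioi_rpow_of_lt (by linarith) hε
  have hk' := hk.const_mul (2 * (D - (φ x - ψ x)))
  have hIψ := integrableOn_secondDifference hs hε hψ hψN x y w
  rw [← integral_Ioi_kernel hs hε, ← integral_const_mul, ← integral_add hIψ hk']
  refine setIntegral_mono_on (integrableOn_secondDifference hs hε hφ hφM x y w)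
    (hIψ.add hk') measurableSet_Ioi fun η hη => ?_
  have hη : 0 < η := hε.trans hη
  have hp : 0 < (η ^ (1 + 2 * s))⁻¹ := inv_pos.2 (Real.rpow_pos_of_pos hη _)
  simp only [Real.rpow_neg hη.le, div_eq_mul_inv]
  rw [← add_mul]
  refine mul_le_mul_of_nonneg_right ?_ hp.le
  linarith [hD (x + η • y), hD (x - η • w)]

lemma abs_integral_secondDifference_le {n : ℕ} {s ε M : ℝ} (hs : 0 < s) (hε : 0 < ε)
    {φ : E n → ℝ} (hc : Continuous φ) (hM : ∀ z, |φ z| ≤ M) (x y w : E n) :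
    |∫ η in Ioi ε, (φ (x + η • y) + φ (x - η • w) - 2 * φ x) / η ^ (1 + 2 * s)| ≤
      4 * M * (ε ^ (-(2 * s)) / (2 * s)) := by
  have hK : 0 < ε ^ (-(2 * s)) / (2 * s) := div_pos (Real.rpow_pos_of_pos hε _) (by linarith)
  have h0 : ∀ z : E n, |(fun _ => (0 : ℝ)) z| ≤ 0 := by simp
  have h1 := integral_secondDifference_le (D := M) hs hε hc hM continuous_const h0
    (fun z => by have := abs_le.1 (hM z); linarith) x y w
  have h2 := integral_secondDifference_le (D := M) hs hε continuous_const h0 hc hM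
    (fun z => by have := abs_le.1 (hM z); linarith) x y w
  simp only [add_zero, mul_zero, sub_zero, zero_div, integral_zero, zero_add, zero_sub] at h1 h2
  have h3 := abs_le.1 (hM x)
  rw [abs_le]
  constructor <;> nlinarith

lemma ciSup_ciInf_le_add {ι κ : Type*} [Nonempty ι] [Nonempty κ] {F G : ι → κ → ℝ} {A B c : ℝ}
    (hF : ∀ i k, |F i k| ≤ A) (hG : ∀ i k, |G i k| ≤ B) (h : ∀ i k, F i k ≤ G i k + c) :
    ⨆ i, ⨅ k, F i k ≤ (⨆ i, ⨅ k, G i k) + c := by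
  have hbF : ∀ i, BddBelow (range (F i)) := fun i =>
    ⟨-A, by rintro _ ⟨k, rfl⟩; exact (abs_le.1 (hF i k)).1⟩
  have hbG : ∀ i, BddBelow (range (G i)) := fun i =>
    ⟨-B, by rintro _ ⟨k, rfl⟩; exact (abs_le.1 (hG i k)).1⟩
  have hsG : BddAbove (range fun i => ⨅ k, G i k) :=
    ⟨B, by
      rintro _ ⟨i, rfl⟩
      obtain ⟨k⟩ := ‹Nonempty κ›
      exact (ciInf_le (hbG i) k).trans (abs_le.1 (hG i k)).2⟩
  refine ciSup_le fun i => ?_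
  have h1 : (⨅ k, F i k) - c ≤ ⨅ k, G i k :=
    le_ciInf fun k => by linarith [ciInf_le (hbF i) k, h i k]
  linarith [le_ciSup hsG i]

lemma nonempty_unitSphere {n : ℕ} (hn : 1 ≤ n) : Nonempty {y : E n // ‖y‖ = 1} :=
  ⟨⟨EuclideanSpace.single ⟨0, hn⟩ 1, by simp⟩⟩

lemma iflTrunc_le_add {n : ℕ} (hn : 1 ≤ n) {s Cs ε M N D : ℝ} (hs : 0 < s) (hCs : 0 < Cs)
    (hε : 0 < ε) {φ ψ : E n → ℝ} (hφ : Continuous φ) (hφM : ∀ z, |φ z| ≤ M)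
    (hψ : Continuous ψ) (hψN : ∀ z, |ψ z| ≤ N) (hD : ∀ z, φ z - ψ z ≤ D) (x : E n) :
    iflTrunc n s Cs ε φ x ≤ iflTrunc n s Cs ε ψ x +
      Cs * (2 * (D - (φ x - ψ x)) * (ε ^ (-(2 * s)) / (2 * s))) := by
  have := nonempty_unitSphere hn
  unfold iflTrunc
  rw [← mul_add]
  refine mul_le_mul_of_nonneg_left ?_ hCs.le
  exact ciSup_ciInf_le_add
    (fun y w => abs_integral_secondDifference_le hs hε hφ hφM x y w)
    (fun y w => abs_integral_secondDifference_le hs hε hψ hψN x y w)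
    (fun y w => integral_secondDifference_le hs hε hφ hφM hψ hψN hD x y w)

lemma iflTrunc_zero (n : ℕ) (s Cs ε : ℝ) (x : E n) :
    iflTrunc n s Cs ε (fun _ => 0) x = 0 := by
  simp [iflTrunc]

lemma abs_iflTrunc_le {n : ℕ} (hn : 1 ≤ n) {s Cs ε M : ℝ} (hs : 0 < s) (hCs : 0 < Cs)
    (hε : 0 < ε) {φ : E n → ℝ} (hc : Continuous φ) (hM : ∀ z, |φ z| ≤ M) (x : E n) :
    |iflTrunc n s Cs ε φ x| ≤ Cs * (4 * M * (ε ^ (-(2 * s)) / (2 * s))) := by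
  have hK : 0 < Cs * (ε ^ (-(2 * s)) / (2 * s)) :=
    mul_pos hCs (div_pos (Real.rpow_pos_of_pos hε _) (by linarith))
  have h0 : ∀ z : E n, |(fun _ => (0 : ℝ)) z| ≤ 0 := by simp
  have h1 := iflTrunc_le_add (D := M) hn hs hCs hε hc hM continuous_const h0
    (fun z => by have := abs_le.1 (hM z); linarith) x
  have h2 := iflTrunc_le_add (D := M) hn hs hCs hε continuous_const h0 hc hM
    (fun z => by have := abs_le.1 (hM z); linarith) x
  rw [iflTrunc_zero] at h1 h2
  have h3 := abs_le.1 (hM x)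
  rw [abs_le]
  constructor <;> nlinarith

lemma iflTrunc_comp_add_right (n : ℕ) (s Cs ε : ℝ) (φ : E n → ℝ) (h x : E n) :
    iflTrunc n s Cs ε (fun z => φ (z + h)) x = iflTrunc n s Cs ε φ (x + h) := by
  simp only [iflTrunc, add_right_comm x _ h, sub_add_eq_add_sub x _ h]

/-- Under the CFL condition the explicit Euler step is nonexpansive in the sup norm. -/
lemma euler_step_sub_le {n : ℕ} (hn : 1 ≤ n) {s Cs ε τ M N D : ℝ} (hs : 0 < s) (hCs : 0 < Cs)
    (hε : 0 < ε) (hτ : 0 < τ) (hCFL : τ ≤ s * ε ^ (2 * s) / Cs) {φ ψ : E n → ℝ}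
    (hφ : Continuous φ) (hφM : ∀ z, |φ z| ≤ M) (hψ : Continuous ψ) (hψN : ∀ z, |ψ z| ≤ N)
    (hD : ∀ z, φ z - ψ z ≤ D) (x : E n) :
    (φ x + τ * iflTrunc n s Cs ε φ x) - (ψ x + τ * iflTrunc n s Cs ε ψ x) ≤ D := by
  have h := mul_le_mul_of_nonneg_left
    (iflTrunc_le_add hn hs hCs hε hφ hφM hψ hψN hD x) hτ.le
  have hp : 0 < ε ^ (2 * s) := Real.rpow_pos_of_pos hε _
  have hc : τ * Cs * 2 * (ε ^ (-(2 * s)) / (2 * s)) ≤ 1 := by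
    rw [le_div_iff₀ hCs] at hCFL
    rw [Real.rpow_neg hε.le]
    have : τ * Cs * 2 * ((ε ^ (2 * s))⁻¹ / (2 * s)) = τ * Cs / (s * ε ^ (2 * s)) := by
      field_simp
    rw [this]
    exact (div_le_one (by positivity)).2 hCFL
  have h2 := mul_le_mul_of_nonneg_right hc (sub_nonneg.2 (hD x))
  linarith

lemma abs_euler_step_sub_le {n : ℕ} (hn : 1 ≤ n) {s Cs ε τ M N D : ℝ} (hs : 0 < s)
    (hCs : 0 < Cs) (hε : 0 < ε) (hτ : 0 < τ) (hCFL : τ ≤ s * ε ^ (2 * s) / Cs)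
    {φ ψ : E n → ℝ} (hφ : Continuous φ) (hφM : ∀ z, |φ z| ≤ M) (hψ : Continuous ψ)
    (hψN : ∀ z, |ψ z| ≤ N) (hD : ∀ z, |φ z - ψ z| ≤ D) (x : E n) :
    |(φ x + τ * iflTrunc n s Cs ε φ x) - (ψ x + τ * iflTrunc n s Cs ε ψ x)| ≤ D := by
  have h1 := euler_step_sub_le hn hs hCs hε hτ hCFL hφ hφM hψ hψN
    (fun z => (abs_le.1 (hD z)).2) x
  have h2 := euler_step_sub_le (D := D) hn hs hCs hε hτ hCFL hψ hψN hφ hφM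
    (fun z => by have := (abs_le.1 (hD z)).1; linarith) x
  rw [abs_le]
  constructor <;> linarith

/-- Translation invariance and nonexpansiveness make the Euler step preserve moduli of
continuity. -/
lemma uniformContinuous_euler_step {n : ℕ} (hn : 1 ≤ n) {s Cs ε τ M : ℝ} (hs : 0 < s)
    (hCs : 0 < Cs) (hε : 0 < ε) (hτ : 0 < τ) (hCFL : τ ≤ s * ε ^ (2 * s) / Cs)
    {φ : E n → ℝ} (hφ : UniformContinuous φ) (hφM : ∀ z, |φ z| ≤ M) :
    UniformContinuous fun x => φ x + τ * iflTrunc n s Cs ε φ x := by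
  have hc := hφ.continuous
  rw [Metric.uniformContinuous_iff] at hφ ⊢
  intro r hr
  obtain ⟨δ, hδ, H⟩ := hφ (r / 2) (half_pos hr)
  refine ⟨δ, hδ, fun {a b} hab => ?_⟩
  have hD : ∀ z, |φ (z + (a - b)) - φ z| ≤ r / 2 := fun z => by
    have : dist (z + (a - b)) z < δ := by rwa [dist_self_add_left, ← dist_eq_norm]
    exact (H this).le
  have h := abs_euler_step_sub_le hn hs hCs hε hτ hCFL
    (φ := fun z => φ (z + (a - b))) (by fun_prop) (fun z => hφM _) hc hφM hD b
  rw [iflTrunc_comp_add_right, add_sub_cancel] at h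
  rw [Real.dist_eq]
  linarith

/-- equicontinuity in time for the semi-discrete scheme:
`sup_x |U^{j+k}(x) − U^j(x)| ≤ k τ sup_x |L_ε[u₀](x)|`. -/
theorem scheme_equicontinuity_time
    (n : ℕ) (hn : 1 ≤ n) (s Cs : ℝ) (hs : s ∈ Ioo (1/2 : ℝ) 1) (hCs : 0 < Cs)
    (ε τ : ℝ) (hε : 0 < ε) (hτ : 0 < τ) (hCFL : τ ≤ s * ε ^ (2*s) / Cs)
    (u₀ : E n → ℝ) (hb : ∃ M, ∀ z, |u₀ z| ≤ M) (huc : UniformContinuous u₀)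
    (U : ℕ → E n → ℝ) (hU0 : U 0 = u₀)
    (hUrec : ∀ j x, U (j+1) x = U j x + τ * iflTrunc n s Cs ε (U j) x) :
    ∀ (j k : ℕ) (x : E n),
      |U (j + k) x - U j x| ≤ (k : ℝ) * τ * ⨆ z, |iflTrunc n s Cs ε u₀ z| := by
  have hs0 : 0 < s := by linarith [hs.1]
  have hreg : ∀ j, (∃ M, ∀ z, |U j z| ≤ M) ∧ UniformContinuous (U j) := by
    intro j
    induction j with
    | zero => rw [hU0]; exact ⟨hb, huc⟩
    | succ j ih =>
      obtain ⟨⟨M, hM⟩, hc⟩ := ih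
      have hstep : U (j + 1) = fun x => U j x + τ * iflTrunc n s Cs ε (U j) x :=
        funext (hUrec j)
      rw [hstep]
      refine ⟨⟨M + τ * (Cs * (4 * M * (ε ^ (-(2 * s)) / (2 * s)))), fun z => ?_⟩,
        uniformContinuous_euler_step hn hs0 hCs hε hτ hCFL hc hM⟩
      refine (abs_add_le _ _).trans (add_le_add (hM z) ?_)
      rw [abs_mul, abs_of_pos hτ]
      exact mul_le_mul_of_nonneg_left
        (abs_iflTrunc_le hn hs0 hCs hε hc.continuous hM z) hτ.le
  have hone : ∀ j x, |U (j + 1) x - U j x| ≤ τ * ⨆ z, |iflTrunc n s Cs ε u₀ z| := by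
    intro j
    induction j with
    | zero =>
      intro x
      obtain ⟨M, hM⟩ := hb
      rw [hUrec, hU0, add_sub_cancel_left, abs_mul, abs_of_pos hτ]
      refine mul_le_mul_of_nonneg_left
        (le_ciSup (f := fun z => |iflTrunc n s Cs ε u₀ z|)
          ⟨Cs * (4 * M * (ε ^ (-(2 * s)) / (2 * s))), ?_⟩ x) hτ.le
      rintro _ ⟨z, rfl⟩
      exact abs_iflTrunc_le hn hs0 hCs hε huc.continuous hM z
    | succ j ih =>
      intro x
      obtain ⟨⟨M, hM⟩, hc⟩ := hreg j
      obtain ⟨⟨N, hN⟩, hc'⟩ := hreg (j + 1)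
      have h := abs_euler_step_sub_le hn hs0 hCs hε hτ hCFL hc'.continuous hN hc.continuous hM ih x
      rwa [← hUrec (j + 1), ← hUrec j] at h
  intro j k x
  induction k with
  | zero => simp
  | succ k ih =>
    have h1 := hone (j + k) x
    have h2 := abs_sub_le (U (j + k + 1) x) (U (j + k) x) (U j x)
    rw [← add_assoc]
    push_cast
    linarith
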